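/- Let G and G′ be finite simple graphs on the same vertex set V, and let S ⊆ V be such that every edge in the symmetric difference E(G) Δ E(G′) has both of its endpoints in S. Then box(G) ≤ 2 · box(G′) + box(G[S]), where G[S] is the induced subgraph of G on S. -/

import Mathlib

/-- A finite simple graph `H` is an interval graph if there is an assignment of
real intervals `[l v, r v]` (with `l v ≤ r v`) to the vertices such that distinct
vertices are adjacent iff their intervals intersect. -/
def IsIntervalGraph {V : Type*} (H : SimpleGraph V) : Prop :=
  ∃ l r : V → ℝ, (∀ v, l v ≤ r v) ∧
    ∀ u v : V, u ≠ v →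
      (H.Adj u v ↔ (Set.Icc (l u) (r u) ∩ Set.Icc (l v) (r v)).Nonempty)

/-- The boxicity of `G` : the least `k` such that `G` is the edge-intersection of
`k` interval graphs on the same vertex set. -/
noncomputable def boxicity {V : Type*} (G : SimpleGraph V) : ℕ :=
  sInf {k | ∃ I : Fin k → SimpleGraph V,
    (∀ i, IsIntervalGraph (I i)) ∧ ∀ u v : V, G.Adj u v ↔ ∀ i, (I i).Adj u v}

/-- The coordinate intervals `[l i v, r i v]`, `i : ι`, represent `G` as an intersection graph of
boxes. The condition `u ≠ v` stands inside the quantifier over `i`, as it does in `boxicity`. -/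
def IsBoxRepresentation {V ι : Type*} (G : SimpleGraph V) (l r : ι → V → ℝ) : Prop :=
  (∀ i v, l i v ≤ r i v) ∧
    ∀ u v, G.Adj u v ↔ ∀ i, u ≠ v ∧ l i u ≤ r i v ∧ l i v ≤ r i u

theorem nonempty_Icc_inter_Icc_iff {a b c d : ℝ} (hab : a ≤ b) (hcd : c ≤ d) :
    (Set.Icc a b ∩ Set.Icc c d).Nonempty ↔ a ≤ d ∧ c ≤ b := by
  rw [Set.Icc_inter_Icc, Set.nonempty_Icc, sup_le_iff, le_inf_iff, le_inf_iff]
  tauto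

/-- The intersection graph of the intervals `[l v, r v]`. -/
def intervalGraph {V : Type*} (l r : V → ℝ) : SimpleGraph V where
  Adj u v := u ≠ v ∧ l u ≤ r v ∧ l v ≤ r u
  symm := ⟨fun _ _ h => ⟨h.1.symm, h.2.2, h.2.1⟩⟩
  loopless := ⟨fun _ h => h.1 rfl⟩

theorem isIntervalGraph_intervalGraph {V : Type*} {l r : V → ℝ} (h : ∀ v, l v ≤ r v) :
    IsIntervalGraph (intervalGraph l r) :=
  ⟨l, r, h, fun u v huv => by
    rw [nonempty_Icc_inter_Icc_iff (h u) (h v)]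
    exact and_iff_right huv⟩

theorem IsBoxRepresentation.exists_intervalGraphs {V ι : Type*} [Fintype ι] {G : SimpleGraph V}
    {l r : ι → V → ℝ} (h : IsBoxRepresentation G l r) :
    ∃ I : Fin (Fintype.card ι) → SimpleGraph V,
      (∀ i, IsIntervalGraph (I i)) ∧ ∀ u v : V, G.Adj u v ↔ ∀ i, (I i).Adj u v := by
  let e := (Fintype.equivFin ι).symm
  refine ⟨fun i => intervalGraph (l (e i)) (r (e i)),
    fun i => isIntervalGraph_intervalGraph (h.1 (e i)), fun u v => ?_⟩
  rw [h.2 u v, ← e.forall_congr_right]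
  rfl

theorem IsBoxRepresentation.boxicity_le {V ι : Type*} [Fintype ι] {G : SimpleGraph V}
    {l r : ι → V → ℝ} (h : IsBoxRepresentation G l r) : boxicity G ≤ Fintype.card ι :=
  Nat.sInf_le h.exists_intervalGraphs

open Classical in
/-- In coordinate `a`, the vertex `a` sits at `0`, its non-neighbours at `1`, and its neighbours
occupy `[0, 1]`. -/
theorem isBoxRepresentation_neighbors {V : Type*} (G : SimpleGraph V) :
    IsBoxRepresentation G (fun a v => if v = a ∨ G.Adj a v then 0 else 1)
      (fun a v => if v = a then 0 else 1) := by
  refine ⟨fun a v => ?_, fun u v => ⟨fun h a => ⟨h.ne, ?_, ?_⟩, fun h => ?_⟩⟩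
  · by_cases hv : v = a <;> simp [hv]
    split_ifs <;> norm_num
  · by_cases hv : v = a
    · subst hv; simp [h.symm]
    · simp only [hv, if_false]; split_ifs <;> norm_num
  · by_cases hu : u = a
    · subst hu; simp [h]
    · simp only [hu, if_false]; split_ifs <;> norm_num
  · obtain ⟨hne, -, hle⟩ := h u
    by_contra hadj
    norm_num [hne.symm, hadj] at hle

theorem exists_isBoxRepresentation {V : Type*} [Finite V] (G : SimpleGraph V) :
    ∃ l r : Fin (boxicity G) → V → ℝ, IsBoxRepresentation G l r := by
  have := Fintype.ofFinite V
  obtain ⟨I, hI, hG⟩ : boxicity G ∈ {k | ∃ I : Fin k → SimpleGraph V,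
      (∀ i, IsIntervalGraph (I i)) ∧ ∀ u v : V, G.Adj u v ↔ ∀ i, (I i).Adj u v} :=
    Nat.sInf_mem ⟨_, (isBoxRepresentation_neighbors G).exists_intervalGraphs⟩
  choose l r hle hadj using hI
  refine ⟨l, r, hle, fun u v => (hG u v).trans (forall_congr' fun i => ?_)⟩
  constructor
  · intro h
    exact ⟨h.ne, (nonempty_Icc_inter_Icc_iff (hle i u) (hle i v)).1 ((hadj i u v h.ne).1 h)⟩
  · rintro ⟨hne, h⟩
    exact (hadj i u v hne).2 ((nonempty_Icc_inter_Icc_iff (hle i u) (hle i v)).2 h)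

theorem exists_forall_abs_le {ι V : Type*} [Finite ι] [Finite V] (f : ι → V → ℝ) :
    ∃ M, ∀ i v, |f i v| ≤ M := by
  obtain ⟨M, hM⟩ := (Set.finite_range fun p : ι × V => |f p.1 p.2|).bddAbove
  exact ⟨M, fun i v => hM ⟨(i, v), rfl⟩⟩

theorem IsBoxRepresentation.exists_bounded {V ι : Type*} [Finite V] [Finite ι] {G : SimpleGraph V}
    {l r : ι → V → ℝ} (h : IsBoxRepresentation G l r) :
    ∃ M, 0 ≤ M ∧ ∀ i v, -M ≤ l i v ∧ l i v ≤ r i v ∧ r i v ≤ M := by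
  obtain ⟨A, hA⟩ := exists_forall_abs_le l
  obtain ⟨B, hB⟩ := exists_forall_abs_le r
  refine ⟨max 0 (max A B), le_max_left _ _, fun i v => ⟨?_, h.1 i v, ?_⟩⟩
  · have := (abs_le.1 (hA i v)).1
    have : A ≤ max 0 (max A B) := by simp
    linarith
  · have := (abs_le.1 (hB i v)).2
    have : B ≤ max 0 (max A B) := by simp
    linarith

open Classical in
/-- Every coordinate of a representation of `G'` is used twice, with the intervals of the vertices
in `S` extended far to the right and far to the left, respectively. Every coordinate of a
representation of `G[S]` is used once, with long intervals for the vertices outside `S`. -/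
theorem exists_isBoxRepresentation_of_symmDiff_subset {V ι κ : Type*} [Finite V] [Finite ι]
    [Finite κ] {G G' : SimpleGraph V} {S : Set V}
    (h : ∀ u v : V, ¬(G.Adj u v ↔ G'.Adj u v) → u ∈ S ∧ v ∈ S)
    {l r : ι → V → ℝ} (hG' : IsBoxRepresentation G' l r)
    {p q : κ → S → ℝ} (hS : IsBoxRepresentation (G.induce S) p q) :
    ∃ L R : (ι ⊕ ι) ⊕ κ → V → ℝ, IsBoxRepresentation G L R := by
  obtain ⟨M, -, hM⟩ := hG'.exists_bounded
  obtain ⟨N, hN0, hN⟩ := hS.exists_bounded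
  refine ⟨Sum.elim (Sum.elim l fun i v => if v ∈ S then -M else l i v)
      fun j v => if hv : v ∈ S then p j ⟨v, hv⟩ else -N,
    Sum.elim (Sum.elim (fun i v => if v ∈ S then M else r i v) r)
      fun j v => if hv : v ∈ S then q j ⟨v, hv⟩ else N, ?_, fun u v => ?_⟩
  · rintro ((i | i) | j) v
    · have := hM i v
      dsimp; split_ifs <;> linarith
    · have := hM i v
      dsimp; split_ifs <;> linarith
    · by_cases hv : v ∈ S
      · simpa [hv] using hS.1 j ⟨v, hv⟩
      · simp only [Sum.elim_inr, hv, dite_false]; linarith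
  · simp only [Sum.forall, Sum.elim_inl, Sum.elim_inr]
    by_cases huv : u ∈ S ∧ v ∈ S
    · obtain ⟨hu, hv⟩ := huv
      have key := hS.2 ⟨u, hu⟩ ⟨v, hv⟩
      simp only [SimpleGraph.comap_adj, Function.Embedding.subtype_apply, ne_eq,
        Subtype.mk.injEq] at key
      simp only [hu, hv, if_true, dite_true]
      constructor
      · intro hadj
        refine ⟨⟨fun i => ⟨hadj.ne, ?_⟩, fun i => ⟨hadj.ne, ?_⟩⟩, key.1 hadj⟩ <;>
          constructor <;> linarith [hM i u, hM i v]
      · exact fun hadj => key.2 hadj.2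
    · have hiff : G.Adj u v ↔ G'.Adj u v := by
        by_contra hne
        exact huv (h u v hne)
      constructor
      · intro hadj
        have key := (hG'.2 u v).1 (hiff.1 hadj)
        refine ⟨⟨fun i => ⟨hadj.ne, ?_⟩, fun i => ⟨hadj.ne, ?_⟩⟩, fun j => ⟨hadj.ne, ?_⟩⟩
        · obtain ⟨-, hle, hle'⟩ := key i
          constructor <;> split_ifs <;> linarith [hM i u, hM i v]
        · obtain ⟨-, hle, hle'⟩ := key i
          constructor <;> split_ifs <;> linarith [hM i u, hM i v]
        · by_cases hu : u ∈ S
          · have hv : v ∉ S := fun hv => huv ⟨hu, hv⟩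
            simp only [hu, hv, dite_true, dite_false]
            constructor <;> linarith [hN j ⟨u, hu⟩]
          · by_cases hv : v ∈ S
            · simp only [hu, hv, dite_true, dite_false]
              constructor <;> linarith [hN j ⟨v, hv⟩]
            · simp only [hu, hv, dite_false]
              constructor <;> linarith
      · rintro ⟨⟨hright, hleft⟩, -⟩
        refine hiff.2 ((hG'.2 u v).2 fun i => ⟨(hright i).1, ?_⟩)
        obtain ⟨-, h₁, h₂⟩ := hright i
        obtain ⟨-, h₃, h₄⟩ := hleft i
        by_cases hu : u ∈ S
        · have hv : v ∉ S := fun hv => huv ⟨hu, hv⟩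
          simp only [hu, hv, if_true, if_false] at h₁ h₂ h₃ h₄
          exact ⟨h₁, h₄⟩
        · by_cases hv : v ∈ S
          · simp only [hu, hv, if_true, if_false] at h₁ h₂ h₃ h₄
            exact ⟨h₃, h₂⟩
          · simp only [hu, hv, if_false] at h₁ h₂
            exact ⟨h₁, h₂⟩

/-- If every edge in the symmetric difference of `E(G)` and `E(G')` has both of its
endpoints in `S`, then `box(G) ≤ 2 · box(G') + box(G[S])`. -/
theorem boxicity_le_two_mul_add_of_symmDiff_subset
    {V : Type*} [Fintype V] (G G' : SimpleGraph V) (S : Set V)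
    (h : ∀ u v : V, ¬(G.Adj u v ↔ G'.Adj u v) → u ∈ S ∧ v ∈ S) :
    boxicity G ≤ 2 * boxicity G' + boxicity (G.induce S) := by
  obtain ⟨l, r, hG'⟩ := exists_isBoxRepresentation G'
  obtain ⟨p, q, hS⟩ := exists_isBoxRepresentation (G.induce S)
  obtain ⟨L, R, hG⟩ := exists_isBoxRepresentation_of_symmDiff_subset h hG' hS
  refine hG.boxicity_le.trans_eq ?_
  simp only [Fintype.card_sum, Fintype.card_fin]
  ring
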